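/- For all natural numbers m, n ≥ 2, over Σ = {a, b} with independence relation I = {(a,b),(b,a)}, let K_{m,n} ⊆ Σ* be the trace closure {w | w ∼_I v for some v ∈ (a^m)^+ (b^n)^+} of the language (a^m)^+(b^n)^+. Then there exists no I-diamond deterministic Büchi automaton recognizing the ω-language [lim(K_{m,n})]_{≈_I}. -/

import Mathlib

open Relation

variable {A : Type*} {σ : Type*} {S : Type*}

/-- The length-`n` prefix of an ω-word. -/
def wpre (α : ℕ → A) (n : ℕ) : List A := (List.range n).map α

/-- One swap of two adjacent independent letters. -/
def SwapStep (I : A → A → Prop) (u v : List A) : Prop :=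
  ∃ (x y : List A) (a b : A), I a b ∧ u = x ++ a :: b :: y ∧ v = x ++ b :: a :: y

/-- Trace equivalence `∼_I` on finite words: the equivalence closure of adjacent swaps. -/
def TrEq (I : A → A → Prop) : List A → List A → Prop := EqvGen (SwapStep I)

/-- Trace-prefix relation `u ⊑_I v`. -/
def TrPre (I : A → A → Prop) (u v : List A) : Prop := ∃ w, TrEq I (u ++ w) v

/-- Trace equivalence `≈_I` of ω-words. -/
def OmEq (I : A → A → Prop) (α β : ℕ → A) : Prop :=
  (∀ n, ∃ m, TrPre I (wpre α n) (wpre β m)) ∧ (∀ n, ∃ m, TrPre I (wpre β n) (wpre α m))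

/-- A language of finite words is trace-closed. -/
def TraceClosed (I : A → A → Prop) (K : Set (List A)) : Prop :=
  ∀ u v, u ∈ K → TrEq I u v → v ∈ K

/-- An ω-language is trace-closed. -/
def OmTraceClosed (I : A → A → Prop) (L : Set (ℕ → A)) : Prop :=
  ∀ α β, α ∈ L → OmEq I α β → β ∈ L

/-- `ext(K)`: ω-words with some finite prefix in `K`. -/
def extL (K : Set (List A)) : Set (ℕ → A) := {α | ∃ n, wpre α n ∈ K}

/-- `lim(K)`: ω-words with infinitely many finite prefixes in `K`. -/
def limL (K : Set (List A)) : Set (ℕ → A) := {α | ∀ N, ∃ n ≥ N, wpre α n ∈ K}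

/-- `[L]_{≈_I}`: the ω-trace closure of an ω-language. -/
def omCl (I : A → A → Prop) (L : Set (ℕ → A)) : Set (ℕ → A) := {α | ∃ β ∈ L, OmEq I α β}

/-- The `I`-suffix extension `K_I`. -/
def suffExt (I : A → A → Prop) (K : Set (List A)) : Set (List A) :=
  K ∪ {w | ∃ (a : A) (u x : List A),
    u ++ [a] ∈ K ∧ (∀ b ∈ x, I a b) ∧ TrEq I w (u ++ [a] ++ x)}

/-- A language is regular iff it is recognized by a DFA with finitely many states. -/
def RegularLang (K : Set (List A)) : Prop :=
  ∃ (σ : Type) (_ : Fintype σ) (M : DFA A σ), ∀ w, w ∈ M.accepts ↔ w ∈ K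

/-- A DFA is `I`-diamond. -/
def IDiamond (I : A → A → Prop) (M : DFA A σ) : Prop :=
  ∀ q a b, I a b → M.step (M.step q a) b = M.step (M.step q b) a

/-- The ω-language of a DFA viewed as a deterministic Büchi automaton. -/
def BuchiLang (M : DFA A σ) : Set (ℕ → A) :=
  {α | ∀ N, ∃ n ≥ N, M.evalFrom M.start (wpre α n) ∈ M.accept}

/-- The weakness condition: mutually reachable states agree on acceptance. -/
def IsWeak (M : DFA A σ) : Prop :=
  ∀ q q', (∃ u, M.evalFrom q u = q') → (∃ v, M.evalFrom q' v = q) →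
    (q ∈ M.accept ↔ q' ∈ M.accept)

/-- States visited infinitely often by the run of a DFA on an ω-word. -/
def InfStates (M : DFA A σ) (α : ℕ → A) : Set σ :=
  {q | ∀ N, ∃ n ≥ N, M.evalFrom M.start (wpre α n) = q}

/-- The ω-language of a DFA equipped with a Muller acceptance family. -/
def MullerLang (M : DFA A σ) (F : Set (Set σ)) : Set (ℕ → A) := {α | InfStates M α ∈ F}

/-- An ω-language is ω-regular iff it is recognized by a deterministic Muller automaton. -/
def OmegaRegular (L : Set (ℕ → A)) : Prop :=
  ∃ (σ : Type) (_ : Fintype σ) (M : DFA A σ) (F : Set (Set σ)), MullerLang M F = L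

/-- Finite Boolean combinations of a family of sets. -/
inductive BoolComb {X : Type*} (G : Set (Set X)) : Set X → Prop
  | base {L} : L ∈ G → BoolComb G L
  | compl {L} : BoolComb G L → BoolComb G Lᶜ
  | union {L₁ L₂} : BoolComb G L₁ → BoolComb G L₂ → BoolComb G (L₁ ∪ L₂)
  | inter {L₁ L₂} : BoolComb G L₁ → BoolComb G L₂ → BoolComb G (L₁ ∩ L₂)

/-- `φ : Σ* → S` is a monoid homomorphism (words under concatenation). -/
def IsHom [Monoid S] (φ : List A → S) : Prop :=
  φ [] = 1 ∧ ∀ u v, φ (u ++ v) = φ u * φ v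

/-- Linked pair of a monoid. -/
def LinkedPair [Monoid S] (s e : S) : Prop := s * e = s ∧ e * e = e

/-- The factor `α[i, j)` of an ω-word. -/
def seg (α : ℕ → A) (i j : ℕ) : List A := (List.range (j - i)).map (fun k => α (i + k))

/-- `φ⁻¹(s)·(φ⁻¹(e))^ω`: ω-words admitting a factorization `u·v₁·v₂⋯` with
`φ(u) = s` and `φ(vᵢ) = e`. -/
def LPWords (φ : List A → S) (s e : S) : Set (ℕ → A) :=
  {α | ∃ n : ℕ → ℕ, StrictMono n ∧ φ (wpre α (n 0)) = s ∧
    ∀ i, φ (seg α (n i) (n (i + 1))) = e}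

/-- `φ` saturates an ω-language `L`. -/
def Saturates [Monoid S] (φ : List A → S) (L : Set (ℕ → A)) : Prop :=
  ∀ s e : S, LinkedPair s e → LPWords φ s e ∩ L = ∅ ∨ LPWords φ s e ⊆ L

/-- The `P`-cut property of a linked pair `(s, e)` with respect to `φ`. -/
def PCut [Monoid S] (φ : List A → S) (P : Set S) (s e : S) : Prop :=
  (∀ w : List A, w ≠ [] → φ w = e →
      ∃ j, 1 ≤ j ∧ j ≤ w.length ∧ s * e * φ (w.take j) ∈ P) ∨
  (∀ w : List A, w ≠ [] → φ w = e →
      ∀ j, 1 ≤ j → j ≤ w.length → s * e * φ (w.take j) ∉ P)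

/-- The run from `q` on `u` visits an accepting state (endpoints included). -/
def VisitsAcc (M : DFA A σ) (q : σ) (u : List A) : Prop :=
  ∃ p, p <+: u ∧ M.evalFrom q p ∈ M.accept

/-- `q ⇒_u q'`: the run from `q` on `u` ends in `q'` and visits an accepting state. -/
def FICycleClosed (I : A → A → Prop) (M : DFA A σ) : Prop :=
  ∀ u v q, TrEq I u v →
    ((M.evalFrom q u = q ∧ VisitsAcc M q u) ↔ (M.evalFrom q v = q ∧ VisitsAcc M q v))

/-- The full independence relation on the two-letter alphabet `Bool`
(`a := false`, `b := true`). -/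
def I2 : Bool → Bool → Prop := fun x y => x ≠ y

/-- `K_{m,n}`: the trace closure of `(a^m)^+ (b^n)^+`. -/
def K15 (m n : ℕ) : Set (List Bool) :=
  {w | ∃ v, (∃ p ≥ 1, ∃ q ≥ 1,
      v = List.replicate (m * p) false ++ List.replicate (n * q) true) ∧
    TrEq I2 w v}

theorem wpre_succ' (α : ℕ → Bool) (k : ℕ) : wpre α (k+1) = wpre α k ++ [α k] := by
  simp [wpre, List.range_succ]

theorem TrEq.count' {u v : List Bool} (h : TrEq I2 u v) (x : Bool) : u.count x = v.count x := by
  induction h with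
  | rel u v h =>
    obtain ⟨p, q, a, b, -, rfl, rfl⟩ := h
    simp only [List.count_append, List.count_cons]; omega
  | refl => rfl
  | symm _ _ _ ih => exact ih.symm
  | trans _ _ _ _ _ ih1 ih2 => exact ih1.trans ih2

theorem TrEq.cons' {u v : List Bool} (h : TrEq I2 u v) (x : Bool) : TrEq I2 (x :: u) (x :: v) := by
  induction h with
  | rel u v h =>
    obtain ⟨p, q, a, b, hab, rfl, rfl⟩ := h
    exact EqvGen.rel _ _ ⟨x :: p, q, a, b, hab, rfl, rfl⟩
  | refl => exact EqvGen.refl _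
  | symm _ _ _ ih => exact EqvGen.symm _ _ ih
  | trans _ _ _ _ _ ih1 ih2 => exact EqvGen.trans _ _ _ ih1 ih2

theorem TrEq.of_perm' {u v : List Bool} (h : u.Perm v) : TrEq I2 u v := by
  induction h with
  | nil => exact EqvGen.refl _
  | cons x _ ih => exact ih.cons' x
  | swap x y l =>
    by_cases hxy : y = x
    · subst hxy; exact EqvGen.refl _
    · exact EqvGen.rel _ _ ⟨[], l, y, x, hxy, rfl, rfl⟩
  | trans _ _ ih1 ih2 => exact EqvGen.trans _ _ _ ih1 ih2

theorem TrEq.of_count' {u v : List Bool} (hf : u.count false = v.count false)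
    (ht : u.count true = v.count true) : TrEq I2 u v := by
  apply TrEq.of_perm'
  rw [List.perm_iff_count]
  rintro (_ | _) <;> assumption

theorem TrPre.of_count' {u v : List Bool} (hf : u.count false ≤ v.count false)
    (ht : u.count true ≤ v.count true) : TrPre I2 u v := by
  refine ⟨List.replicate (v.count false - u.count false) false ++
    List.replicate (v.count true - u.count true) true, TrEq.of_count' ?_ ?_⟩ <;>
  · simp [List.count_append, List.count_replicate]; omega

theorem TrPre.count' {u v : List Bool} (h : TrPre I2 u v) (x : Bool) :
    u.count x ≤ v.count x := by
  obtain ⟨w, hw⟩ := h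
  have := hw.count' x
  rw [List.count_append] at this
  omega

theorem count_mono' (α : ℕ → Bool) (x : Bool) : Monotone (fun k => (wpre α k).count x) := by
  apply monotone_nat_of_le_succ
  intro k
  simp [wpre_succ', List.count_append]

theorem pre_exists' (α β : ℕ → Bool) (hβ : ∀ x N, ∃ k, N ≤ (wpre β k).count x) (n : ℕ) :
    ∃ m, TrPre I2 (wpre α n) (wpre β m) := by
  obtain ⟨k1, h1⟩ := hβ false ((wpre α n).count false)
  obtain ⟨k2, h2⟩ := hβ true ((wpre α n).count true)
  exact ⟨max k1 k2, TrPre.of_count' (h1.trans (count_mono' β false (le_max_left _ _)))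
    (h2.trans (count_mono' β true (le_max_right _ _)))⟩

theorem K15_count' {m n : ℕ} {w : List Bool} (h : w ∈ K15 m n) :
    m ∣ w.count false ∧ n ∣ w.count true := by
  obtain ⟨v, ⟨p, -, q, -, rfl⟩, h⟩ := h
  rw [h.count' false, h.count' true]
  simp [List.count_append, List.count_replicate]

def alt' : ℕ → Bool := fun k => decide (k % 2 = 1)

theorem alt_count' (k : ℕ) : (wpre alt' (2*k)).count false = k ∧ (wpre alt' (2*k)).count true = k := by
  induction k with
  | zero => simp [wpre]
  | succ k ih =>
    have e0 : alt' (2*k) = false := by simp [alt']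
    have e1 : alt' (2*k+1) = true := by simp [alt']
    rw [show 2*(k+1) = 2*k+1+1 by ring, wpre_succ', wpre_succ', e0, e1]
    simp [List.count_append, ih.1, ih.2]

theorem alt_mem' (m n : ℕ) (hm : 2 ≤ m) (hn : 2 ≤ n) : alt' ∈ limL (K15 m n) := by
  intro N
  have hmn : 1 ≤ m * n := Nat.mul_pos (by omega) (by omega)
  refine ⟨2 * (m * n * (N+1)), by nlinarith, _,
    ⟨n*(N+1), Nat.mul_pos (by omega) (by omega), m*(N+1), Nat.mul_pos (by omega) (by omega), rfl⟩, ?_⟩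
  obtain ⟨h1, h2⟩ := alt_count' (m*n*(N+1))
  apply TrEq.of_count'
  · rw [h1]; simp [List.count_append, List.count_replicate]; ring
  · rw [h2]; simp [List.count_append, List.count_replicate]; ring

theorem mem_omCl' (m n : ℕ) (hm : 2 ≤ m) (hn : 2 ≤ n) (α : ℕ → Bool)
    (hα : ∀ x N, ∃ k, N ≤ (wpre α k).count x) : α ∈ omCl I2 (limL (K15 m n)) := by
  refine ⟨alt', alt_mem' m n hm hn, pre_exists' _ _ ?_, pre_exists' _ _ hα⟩
  rintro (_ | _) N
  · exact ⟨2*N, (alt_count' N).1.ge⟩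
  · exact ⟨2*N, (alt_count' N).2.ge⟩

def bar' (s : ℕ) (x : Bool) : ℕ → Bool := fun k => if k < s then x else !x

theorem bar_count' (s : ℕ) (x : Bool) (k : ℕ) :
    (wpre (bar' s x) k).count x = min k s ∧ (wpre (bar' s x) k).count (!x) = k - s := by
  induction k with
  | zero => simp [wpre]
  | succ k ih =>
    rw [wpre_succ', List.count_append, List.count_append, ih.1, ih.2]
    by_cases h : k < s
    · simp [bar', h]; omega
    · simp [bar', h]; omega

theorem bar_mem' {m n s : ℕ} {x : Bool} (h : bar' s x ∈ omCl I2 (limL (K15 m n))) :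
    (if x then n else m) ∣ s := by
  obtain ⟨β, hβ, h1, h2⟩ := h
  obtain ⟨N, hN⟩ := h1 s
  obtain ⟨k, hk, hK⟩ := hβ N
  obtain ⟨M, hM⟩ := h2 k
  have a1 := hN.count' x
  have a2 := hM.count' x
  rw [(bar_count' s x _).1] at a1 a2
  have a3 := count_mono' β x hk
  have : (wpre β k).count x = s := by simp only [] at a3; omega
  have hc := K15_count' hK
  cases x
  · rw [this] at hc; simpa using hc.1
  · rw [this] at hc; simpa using hc.2

theorem iter_idem' {σ : Type} [Fintype σ] (f : σ → σ) : ∃ c > 0, f^[c + c] = f^[c] := by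
  obtain ⟨i, j, hij, h⟩ := Finite.exists_ne_map_eq_of_infinite (fun k : ℕ => f^[k])
  wlog hlt : i < j generalizing i j
  · exact this j i hij.symm h.symm (by omega)
  obtain ⟨p, rfl⟩ := Nat.exists_eq_add_of_lt hlt
  have key : ∀ t r, f^[r + i + t * (p+1)] = f^[r + i] := by
    intro t
    induction t with
    | zero => simp
    | succ t ih =>
      intro r
      rw [show r + i + (t+1)*(p+1) = (r + t*(p+1)) + (i + p + 1) by ring, Function.iterate_add, ← h,
        ← Function.iterate_add, ← ih r]
      congr 1; ring
  refine ⟨(i+1)*(p+1), by positivity, ?_⟩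
  have e : (i+1)*(p+1) = (i*p + p + 1) + i := by ring
  have := key (i+1) (i*p+p+1)
  rwa [← e] at this

theorem iter_mul' {σ : Type} (f : σ → σ) {c : ℕ} (h : f^[c + c] = f^[c]) (r t : ℕ) :
    f^[r + c + t * c] = f^[r + c] := by
  induction t with
  | zero => simp
  | succ t ih =>
    rw [show r + c + (t+1)*c = (r + t * c) + (c + c) by ring, Function.iterate_add, h,
      ← Function.iterate_add, ← ih]
    congr 1; ring

theorem iter_scale' {σ : Type} (f : σ → σ) {c : ℕ} (h : f^[c + c] = f^[c]) (d : ℕ) (hd : 0 < d) :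
    f^[d * c + d * c] = f^[d * c] := by
  obtain ⟨e, rfl⟩ := Nat.exists_eq_add_of_lt hd
  have := iter_mul' f h (e * c) (e+1)
  rw [show (0 + e + 1) * c = e * c + c by ring]
  rw [← this]; congr 1; ring

theorem eval_count' {σ : Type} (M : DFA Bool σ) (hM : IDiamond I2 M) (x : Bool) (w : List Bool) :
    M.evalFrom M.start w = (fun q => M.step q x)^[w.count x]
      ((fun q => M.step q (!x))^[w.count (!x)] M.start) := by
  have hcomm : Function.Commute (fun q => M.step q x) (fun q => M.step q (!x)) := by
    intro q
    exact hM q (!x) x (by simp [I2])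
  induction w using List.reverseRecOn with
  | nil => simp
  | append_singleton w a ih =>
    rw [DFA.evalFrom_append_singleton, ih, List.count_append, List.count_append]
    by_cases h : a = x
    · subst h
      simp [Function.iterate_succ_apply']
    · have h : a = !x := by cases a <;> cases x <;> simp_all
      subst h
      simp only [List.count_singleton]
      simp [Function.iterate_succ_apply']
      exact ((hcomm.iterate_left _) _).symm

def nxt' (c : ℕ) (p : ℕ × ℕ) : Bool := decide (p.1 % c = 1 ∧ p.2 < p.1)

def pth' (c : ℕ) : ℕ → ℕ × ℕ
  | 0 => (0, 0)
  | k+1 => if nxt' c (pth' c k) then ((pth' c k).1, (pth' c k).2 + 1)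
    else ((pth' c k).1 + 1, (pth' c k).2)

def stair' (c : ℕ) : ℕ → Bool := fun k => nxt' c (pth' c k)

theorem stair_count' (c k : ℕ) : (wpre (stair' c) k).count false = (pth' c k).1 ∧
    (wpre (stair' c) k).count true = (pth' c k).2 := by
  induction k with
  | zero => simp [wpre, pth']
  | succ k ih =>
    rw [wpre_succ', List.count_append, List.count_append, ih.1, ih.2]
    cases h : nxt' c (pth' c k) <;> simp [stair', pth', h]

theorem pth_inv' (c : ℕ) (hc : 2 ≤ c) (k : ℕ) :
    (pth' c (k+1)).1 + (pth' c (k+1)).2 = k+1 ∧ (pth' c (k+1)).2 ≤ (pth' c (k+1)).1 ∧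
    (pth' c (k+1)).1 ≤ (pth' c (k+1)).2 + c ∧
    ((pth' c (k+1)).1 % c = 1 ∨ (pth' c (k+1)).2 % c = 1) := by
  induction k with
  | zero =>
    have : 1 % c = 1 := Nat.mod_eq_of_lt (by omega)
    simp [pth', nxt', this]; omega
  | succ k ih =>
    rw [pth']
    generalize pth' c (k+1) = p at ih ⊢
    obtain ⟨i, j⟩ := p
    simp only at ih
    obtain ⟨h1, h2, h3, h4⟩ := ih
    by_cases h : i % c = 1 ∧ j < i
    · simp only [nxt', h, and_self, decide_true, if_true]
      refine ⟨by omega, by omega, by omega, Or.inl trivial⟩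
    · simp only [nxt', h, decide_false, Bool.false_eq_true, if_false]
      have hj : j % c = 1 := by
        by_cases e : i % c = 1
        · have : i = j := by omega
          exact this ▸ e
        · exact h4.resolve_left e
      have : i ≠ j + c := by
        rintro rfl
        apply h
        rw [Nat.add_mod_right]
        exact ⟨hj, by omega⟩
      exact ⟨by omega, by omega, by omega, Or.inr hj⟩

theorem nonacc' {σ : Type} (M : DFA Bool σ) (hM : IDiamond I2 M) {m n c : ℕ}
    (hm : 2 ≤ m) (hn : 2 ≤ n) (hB : BuchiLang M = omCl I2 (limL (K15 m n)))
    (hc : ∀ x, (fun q => M.step q x)^[c + c] = (fun q => M.step q x)^[c])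
    (hmc : m ∣ c) (hnc : n ∣ c) (hc2 : 2 ≤ c) (x : Bool) (w : List Bool)
    (h1 : w.count x % c = 1) (h2 : c < w.count x) (h3 : c ≤ w.count (!x)) :
    M.evalFrom M.start w ∉ M.accept := by
  intro hacc
  have hmem : bar' (w.count x) x ∈ BuchiLang M := by
    intro N
    refine ⟨w.count x + w.count (!x) + N * c, by nlinarith, ?_⟩
    rw [eval_count' M hM x, (bar_count' _ _ _).1, (bar_count' _ _ _).2]
    rw [eval_count' M hM x] at hacc
    have e1 : min (w.count x + w.count (!x) + N * c) (w.count x) = w.count x := by omega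
    have e2 : w.count x + w.count (!x) + N * c - w.count x = w.count (!x) + N * c := by omega
    obtain ⟨r, hr⟩ := Nat.exists_eq_add_of_le' h3
    rw [e1, e2, hr, iter_mul' _ (hc (!x)) r N, ← hr]
    exact hacc
  rw [hB] at hmem
  have hd := bar_mem' hmem
  have hdm : ∀ d, 2 ≤ d → d ∣ c → ¬ d ∣ w.count x := by
    intro d hd hdc hdw
    have := (Nat.dvd_mod_iff hdc).2 hdw
    rw [h1] at this
    have := Nat.le_of_dvd one_pos this
    omega
  cases x
  · exact hdm m hm hmc (by simpa using hd)
  · exact hdm n hn hnc (by simpa using hd)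

/-- For `m, n ≥ 2`, no `I`-diamond deterministic Büchi automaton
recognizes `[lim(K_{m,n})]_{≈_I}`. -/
theorem stmt15 (m n : ℕ) (hm : 2 ≤ m) (hn : 2 ≤ n) :
    ¬ (∃ (σ : Type) (_ : Fintype σ) (M : DFA Bool σ),
        IDiamond I2 M ∧ BuchiLang M = omCl I2 (limL (K15 m n))) := by
  rintro ⟨σ, _, M, hM, hB⟩
  obtain ⟨c1, h1, e1⟩ := iter_idem' (fun q => M.step q false)
  obtain ⟨c2, h2, e2⟩ := iter_idem' (fun q => M.step q true)
  obtain ⟨c, hc, hc2, hmc, hnc⟩ : ∃ c, (∀ x, (fun q => M.step q x)^[c + c] = (fun q => M.step q x)^[c])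
      ∧ 2 ≤ c ∧ m ∣ c ∧ n ∣ c := by
    refine ⟨(m * n * c2) * c1, ?_, ?_, ?_, ?_⟩
    · rintro (_ | _)
      · exact iter_scale' _ e1 _ (by positivity)
      · have := iter_scale' _ e2 (m * n * c1) (by positivity)
        rwa [show m * n * c1 * c2 = m * n * c2 * c1 by ring] at this
    · have : m ∣ (m * n * c2) * c1 := ⟨n * c2 * c1, by ring⟩
      exact hm.trans (Nat.le_of_dvd (by positivity) this)
    · exact ⟨n * c2 * c1, by ring⟩
    · exact ⟨m * c2 * c1, by ring⟩
  have hmem : stair' c ∈ BuchiLang M := by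
    rw [hB]
    apply mem_omCl' m n hm hn
    intro x N
    refine ⟨2 * N + c + 1, ?_⟩
    have hp := pth_inv' c hc2 (2 * N + c)
    have hs := stair_count' c (2 * N + c + 1)
    cases x
    · rw [hs.1]; omega
    · rw [hs.2]; omega
  obtain ⟨k, hk, hacc⟩ := hmem (4 * c + 4)
  obtain ⟨k, rfl⟩ : ∃ k', k = k' + 1 := ⟨k - 1, by omega⟩
  have hp := pth_inv' c hc2 k
  have hs := stair_count' c (k + 1)
  rw [← hs.1, ← hs.2] at hp
  obtain ⟨p1, p2, p3, p4 | p4⟩ := hp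
  · exact nonacc' M hM hm hn hB hc hmc hnc hc2 false _ p4 (by omega)
      (by simp only [Bool.not_false]; omega) hacc
  · exact nonacc' M hM hm hn hB hc hmc hnc hc2 true _ p4 (by omega)
      (by simp only [Bool.not_true]; omega) hacc
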